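/- For every n ≥ 3, the edge domination number of the pseudofractal scale-free web G_n equals one-ninth of its number of edges, i.e. 9 times the edge domination number of G_n equals the number of edges of G_n. -/

import Mathlib

/-!
Common definitions: the pseudofractal scale-free web `pfw n` (= `G_n` for `n ≥ 1`)
and the Sierpinski graph `sierp n` (= `S_n` for `n ≥ 1`), together with the
edge-domination notions used in the paper.
-/

open scoped Classical

noncomputable section

/-- A finite graph generation: a finite vertex type, a finite set of edges
(unordered pairs of vertices), and three designated hub/outmost vertices. -/
structure GraphGen : Type 1 where
  V : Type
  fin : Fintype V
  edges : Finset (Sym2 V)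
  hubs : Fin 3 → V

attribute [instance] GraphGen.fin

/-- The triangle (complete graph on three vertices), the common first generation. -/
def triangle : GraphGen where
  V := Fin 3
  fin := inferInstance
  edges := {s((0 : Fin 3), (1 : Fin 3)), s((0 : Fin 3), (2 : Fin 3)), s((1 : Fin 3), (2 : Fin 3))}
  hubs := fun i => i

/-- One iteration step of the pseudofractal scale-free web: for every existing
edge `{u,v}` a new vertex is added and joined to both `u` and `v`. -/
def pfwStep (X : GraphGen) : GraphGen where
  V := X.V ⊕ {e : Sym2 X.V // e ∈ X.edges}
  fin := inferInstance
  edges :=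
    X.edges.image (Sym2.map Sum.inl) ∪
      X.edges.attach.biUnion fun e =>
        (Finset.univ.filter fun v : X.V => v ∈ (e : Sym2 X.V)).image fun v =>
          s((Sum.inl v : X.V ⊕ {e : Sym2 X.V // e ∈ X.edges}), Sum.inr e)
  hubs := fun i => Sum.inl (X.hubs i)

private def pfwAux : ℕ → GraphGen
  | 0 => triangle
  | n + 1 => pfwStep (pfwAux n)

/-- `pfw n` is the pseudofractal scale-free web `G_n` (for `n ≥ 1`):
`G_1` is a triangle and `G_{n+1}` is obtained from `G_n` by adding, for each
edge, a new vertex adjacent to both of its endpoints.  Its hubs are the three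
vertices of `G_1`. -/
def pfw (n : ℕ) : GraphGen := pfwAux (n - 1)

/-- The identification relation used to glue three copies of the Sierpinski
graph: `B^(1) ~ A^(2)`, `C^(1) ~ A^(3)`, `C^(2) ~ B^(3)` (copies indexed by
`0, 1, 2` and outmost vertices `A = hubs 0`, `B = hubs 1`, `C = hubs 2`). -/
def sierpRel (X : GraphGen) : Fin 3 × X.V → Fin 3 × X.V → Prop := fun p q =>
  (p = ((0 : Fin 3), X.hubs 1) ∧ q = ((1 : Fin 3), X.hubs 0)) ∨
  (p = ((0 : Fin 3), X.hubs 2) ∧ q = ((2 : Fin 3), X.hubs 0)) ∨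
  (p = ((1 : Fin 3), X.hubs 2) ∧ q = ((2 : Fin 3), X.hubs 1))

/-- One iteration step of the Sierpinski graph: three disjoint copies of the
previous generation are glued along their outmost vertices. -/
def sierpStep (X : GraphGen) : GraphGen where
  V := Quotient (Relation.EqvGen.setoid (sierpRel X))
  fin := inferInstance
  edges :=
    (Finset.univ : Finset (Fin 3)).biUnion fun t =>
      X.edges.image (Sym2.map fun v => Quotient.mk (Relation.EqvGen.setoid (sierpRel X)) (t, v))
  hubs := fun i => Quotient.mk (Relation.EqvGen.setoid (sierpRel X)) (i, X.hubs i)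

private def sierpAux : ℕ → GraphGen
  | 0 => triangle
  | n + 1 => sierpStep (sierpAux n)

/-- `sierp n` is the Sierpinski graph `S_n` (for `n ≥ 1`):
`S_1` is a triangle, and `S_{n+1}` is obtained by gluing three copies of `S_n`
at their outmost vertices.  Its `hubs` are the three outmost vertices. -/
def sierp (n : ℕ) : GraphGen := sierpAux (n - 1)

/-- An edge `e` is dominated by the edge set `F` if it belongs to `F` or
shares an endpoint with some edge of `F`. -/
def Dominated (X : GraphGen) (F : Finset (Sym2 X.V)) (e : Sym2 X.V) : Prop :=
  e ∈ F ∨ ∃ f ∈ F, ∃ v, v ∈ e ∧ v ∈ f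

/-- `F` is an edge dominating set: a set of edges of `X` such that every edge
not in `F` shares an endpoint with some edge of `F`. -/
def IsEDS (X : GraphGen) (F : Finset (Sym2 X.V)) : Prop :=
  F ⊆ X.edges ∧ ∀ e ∈ X.edges, e ∉ F → ∃ f ∈ F, ∃ v, v ∈ e ∧ v ∈ f

/-- The edge domination number: the minimum cardinality of an edge dominating set. -/
def edsNum (X : GraphGen) : ℕ := sInf {k | ∃ F, IsEDS X F ∧ F.card = k}

/-- A minimum edge dominating set: an EDS whose cardinality equals the edge
domination number. -/
def IsMEDS (X : GraphGen) (F : Finset (Sym2 X.V)) : Prop :=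
  IsEDS X F ∧ F.card = edsNum X

/-- Hub number `i` is filled w.r.t. `F`: some edge incident to it lies in `F`. -/
def FilledHub (X : GraphGen) (F : Finset (Sym2 X.V)) (i : Fin 3) : Prop :=
  ∃ f ∈ F, X.hubs i ∈ f

/-- Hub number `i` is cross w.r.t. `F`: no edge incident to it lies in `F` and
some edge incident to it is not dominated by `F`. -/
def CrossHub (X : GraphGen) (F : Finset (Sym2 X.V)) (i : Fin 3) : Prop :=
  ¬ FilledHub X F i ∧ ∃ e ∈ X.edges, X.hubs i ∈ e ∧ ¬ Dominated X F e

/-- Hub number `i` is empty w.r.t. `F`: it is neither filled nor cross. -/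
def EmptyHub (X : GraphGen) (F : Finset (Sym2 X.V)) (i : Fin 3) : Prop :=
  ¬ FilledHub X F i ∧ ¬ CrossHub X F i

/-- `F` is admissible: a set of edges of `X` such that every edge not dominated
by `F` is incident to a cross hub vertex. -/
def Admissible (X : GraphGen) (F : Finset (Sym2 X.V)) : Prop :=
  F ⊆ X.edges ∧
    ∀ e ∈ X.edges, ¬ Dominated X F e → ∃ i, CrossHub X F i ∧ X.hubs i ∈ e

/-- The number of filled hub vertices w.r.t. `F`. -/
def numFilled (X : GraphGen) (F : Finset (Sym2 X.V)) : ℕ :=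
  (Finset.univ.filter fun i : Fin 3 => FilledHub X F i).card

/-- The number of cross hub vertices w.r.t. `F`. -/
def numCross (X : GraphGen) (F : Finset (Sym2 X.V)) : ℕ :=
  (Finset.univ.filter fun i : Fin 3 => CrossHub X F i).card

/-- `minAdm X nf i` is the minimum cardinality of an admissible set with exactly
`nf` filled hub vertices and exactly `i` cross hub vertices. -/
def minAdm (X : GraphGen) (nf i : ℕ) : ℕ :=
  sInf {k | ∃ F, Admissible X F ∧ numFilled X F = nf ∧ numCross X F = i ∧ F.card = k}

/-- The class of admissible sets with exactly `nf` filled and exactly `i` cross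
hub vertices attaining the minimum cardinality among such sets. -/
def admClass (X : GraphGen) (nf i : ℕ) : Set (Finset (Sym2 X.V)) :=
  {F | Admissible X F ∧ numFilled X F = nf ∧ numCross X F = i ∧ F.card = minAdm X nf i}

/-- `a_n^i`: minimum cardinality of an admissible set with no filled hub and `i` cross hubs. -/
def aq (X : GraphGen) (i : ℕ) : ℕ := minAdm X 0 i

/-- `b_n^i`: minimum cardinality of an admissible set with one filled hub and `i` cross hubs. -/
def bq (X : GraphGen) (i : ℕ) : ℕ := minAdm X 1 i

/-- `c_n^i`: minimum cardinality of an admissible set with two filled hubs and `i` cross hubs. -/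
def cq (X : GraphGen) (i : ℕ) : ℕ := minAdm X 2 i

/-- `d_n^i`: minimum cardinality of an admissible set with three filled hubs and `i` cross hubs. -/
def dq (X : GraphGen) (i : ℕ) : ℕ := minAdm X 3 i

end

section

variable {V : Type*} [Fintype V]

/-- One iteration step on edge sets: keep all edges of `E` and join, for each `e ∈ E`, a new
vertex to both endpoints of `e`. -/
noncomputable def stepEdges (E : Finset (Sym2 V)) : Finset (Sym2 (V ⊕ {e : Sym2 V // e ∈ E})) :=
  E.image (Sym2.map Sum.inl) ∪
    E.attach.biUnion fun e =>
      (Finset.univ.filter fun v : V => v ∈ (e : Sym2 V)).image fun v =>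
        s((Sum.inl v : V ⊕ {e : Sym2 V // e ∈ E}), Sum.inr e)

theorem mem_stepEdges {E : Finset (Sym2 V)} {f : Sym2 (V ⊕ {e : Sym2 V // e ∈ E})} :
    f ∈ stepEdges E ↔
      (∃ g ∈ E, g.map Sum.inl = f) ∨
        ∃ e : {e : Sym2 V // e ∈ E}, ∃ v ∈ (e : Sym2 V), s(Sum.inl v, Sum.inr e) = f := by
  simp only [stepEdges, Finset.mem_union, Finset.mem_image, Finset.mem_biUnion, Finset.mem_attach,
    true_and, Finset.mem_filter, Finset.mem_univ]

theorem inr_notMem_map_inl {α β : Type*} (e : Sym2 α) (b : β) :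
    (Sum.inr b : α ⊕ β) ∉ e.map Sum.inl := by
  simp [Sym2.mem_map]

theorem inr_unique_of_mem_stepEdges {E : Finset (Sym2 V)}
    {f : Sym2 (V ⊕ {e : Sym2 V // e ∈ E})} (hf : f ∈ stepEdges E) {e e' : {e : Sym2 V // e ∈ E}}
    (h : Sum.inr e ∈ f) (h' : Sum.inr e' ∈ f) : e = e' := by
  rcases mem_stepEdges.1 hf with ⟨g, -, rfl⟩ | ⟨d, v, -, rfl⟩
  · exact absurd h (inr_notMem_map_inl _ _)
  · have h1 : e = d := by simpa using h
    have h2 : e' = d := by simpa using h'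
    rw [h1, h2]

theorem not_isDiag_of_mem_stepEdges {E : Finset (Sym2 V)} (hE : ∀ e ∈ E, ¬ e.IsDiag) :
    ∀ f ∈ stepEdges E, ¬ f.IsDiag := by
  intro f hf
  rcases mem_stepEdges.1 hf with ⟨g, hg, rfl⟩ | ⟨d, v, -, rfl⟩
  · rw [Sym2.isDiag_map Sum.inl_injective]
    exact hE g hg
  · simp

theorem Sym2.card_filter_mem {e : Sym2 V} (he : ¬ e.IsDiag) :
    (Finset.univ.filter fun v : V => v ∈ e).card = 2 := by
  rw [← Sym2.card_toFinset_of_not_isDiag e he]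
  congr 1
  ext v
  simp

theorem card_stepEdges {E : Finset (Sym2 V)} (hE : ∀ e ∈ E, ¬ e.IsDiag) :
    (stepEdges E).card = 3 * E.card := by
  unfold stepEdges
  rw [Finset.card_union_of_disjoint, Finset.card_image_of_injective _
    (Sym2.map.injective Sum.inl_injective), Finset.card_biUnion]
  · rw [Finset.sum_congr rfl (g := fun _ => 2), Finset.sum_const, Finset.card_attach, smul_eq_mul]
    · ring
    · intro e _
      rw [Finset.card_image_of_injective, Sym2.card_filter_mem (hE e e.2)]
      intro v w h
      simpa using h
  · intro e _ e' _ hne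
    refine Finset.disjoint_left.2 fun f hf hf' => hne ?_
    obtain ⟨v, -, rfl⟩ := Finset.mem_image.1 hf
    obtain ⟨w, -, h⟩ := Finset.mem_image.1 hf'
    simp only [Sym2.eq_iff, Sum.inl.injEq, Sum.inr.injEq, reduceCtorEq, and_self, or_false] at h
    exact h.2.symm
  · refine Finset.disjoint_left.2 fun f hf hf' => ?_
    simp only [Finset.mem_image, Finset.mem_biUnion] at hf hf'
    obtain ⟨g, -, rfl⟩ := hf
    obtain ⟨e, -, v, -, h⟩ := hf'
    exact inr_notMem_map_inl g e (h ▸ Sym2.mem_mk_right _ _)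

/-- One endpoint can be chosen for each edge of `E` so that every vertex is chosen. -/
def HasCoveringChoice (E : Finset (Sym2 V)) : Prop :=
  ∃ c : {e : Sym2 V // e ∈ E} → V, (∀ e : {e : Sym2 V // e ∈ E}, c e ∈ e.1) ∧ Function.Surjective c

theorem hasCoveringChoice_triangle :
    HasCoveringChoice ({s(0, 1), s(0, 2), s(1, 2)} : Finset (Sym2 (Fin 3))) := by
  have key : ∀ e : {e : Sym2 (Fin 3) // e ∈ ({s(0, 1), s(0, 2), s(1, 2)} : Finset _)},
      ∃ v : Fin 3, v ∈ (e : Sym2 (Fin 3)) ∧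
        (e.1 = s(0, 1) → v = 0) ∧ (e.1 = s(0, 2) → v = 2) ∧ (e.1 = s(1, 2) → v = 1) := by
    rintro ⟨e, he⟩
    simp only [Finset.mem_insert, Finset.mem_singleton] at he
    obtain h | h | h := he
    · exact ⟨0, by simp [h]⟩
    · exact ⟨2, by simp [h]⟩
    · exact ⟨1, by simp [h]⟩
  choose c hc h0 h2 h1 using key
  refine ⟨c, hc, fun v => ?_⟩
  fin_cases v
  · exact ⟨⟨s(0, 1), by simp⟩, h0 _ rfl⟩
  · exact ⟨⟨s(1, 2), by simp⟩, h1 _ rfl⟩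
  · exact ⟨⟨s(0, 2), by simp⟩, h2 _ rfl⟩

theorem HasCoveringChoice.step {E : Finset (Sym2 V)} (hE : HasCoveringChoice E) :
    HasCoveringChoice (stepEdges E) := by
  obtain ⟨c, hc, hs⟩ := hE
  have key : ∀ f : {f // f ∈ stepEdges E},
      ∃ y : V ⊕ {e : Sym2 V // e ∈ E}, y ∈ f.1 ∧
        (∀ e : {e : Sym2 V // e ∈ E}, f.1 = e.1.map Sum.inl → y = Sum.inl (c e)) ∧
        (∀ e : {e : Sym2 V // e ∈ E}, Sum.inr e ∈ f.1 → y = Sum.inr e) := by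
    rintro ⟨f, hf⟩
    rcases mem_stepEdges.1 hf with ⟨g, hg, rfl⟩ | ⟨d, v, -, rfl⟩
    · refine ⟨Sum.inl (c ⟨g, hg⟩), Sym2.mem_map.2 ⟨_, hc _, rfl⟩, fun e h => ?_, fun e h => ?_⟩
      · rw [show e = ⟨g, hg⟩ from Subtype.ext (Sym2.map.injective Sum.inl_injective h).symm]
      · exact absurd h (inr_notMem_map_inl _ _)
    · refine ⟨Sum.inr d, Sym2.mem_mk_right _ _, fun e h => ?_, fun e h => ?_⟩
      · exact absurd (h ▸ Sym2.mem_mk_right _ _) (inr_notMem_map_inl e.1 d)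
      · have : e = d := by simpa using h
        rw [this]
  choose k hk hl hr using key
  refine ⟨k, hk, ?_⟩
  rintro (v | e)
  · obtain ⟨e, rfl⟩ := hs v
    exact ⟨⟨e.1.map Sum.inl, mem_stepEdges.2 (Or.inl ⟨e, e.2, rfl⟩)⟩, hl _ e rfl⟩
  · exact ⟨⟨s(Sum.inl (c e), Sum.inr e), mem_stepEdges.2 (Or.inr ⟨e, c e, hc e, rfl⟩)⟩,
      hr _ e (Sym2.mem_mk_right _ _)⟩

/-- `F` is an edge dominating set of the graph with edge set `E`. -/
def EdgeDominating (E F : Finset (Sym2 V)) : Prop :=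
  F ⊆ E ∧ ∀ e ∈ E, e ∉ F → ∃ f ∈ F, ∃ v, v ∈ e ∧ v ∈ f

theorem EdgeDominating.card_le_of_stepEdges {E : Finset (Sym2 V)} {F : Finset (Sym2 _)}
    (hF : EdgeDominating (stepEdges (stepEdges E)) F) : E.card ≤ F.card := by
  have hsub : ∀ f ∈ F, ∃ g ∈ stepEdges E, ∀ e : {e : Sym2 V // e ∈ E},
      (Sum.inl (Sum.inr e) ∈ f → Sum.inr e ∈ g) ∧
      (∀ d : {g // g ∈ stepEdges E}, Sum.inr d ∈ f → Sum.inr e ∈ d.1 → Sum.inr e ∈ g) := by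
    intro f hf
    rcases mem_stepEdges.1 (hF.1 hf) with ⟨g, hg, rfl⟩ | ⟨d, v, hv, rfl⟩
    · refine ⟨g, hg, fun e => ⟨fun h => ?_, fun d h => ?_⟩⟩
      · obtain ⟨y, hy, h⟩ := Sym2.mem_map.1 h
        rwa [← Sum.inl_injective h]
      · exact absurd h (inr_notMem_map_inl _ _)
    · refine ⟨d, d.2, fun e => ⟨fun h => ?_, fun d' h h' => ?_⟩⟩
      · rcases Sym2.mem_iff.1 h with h | h
        · rwa [Sum.inl_injective h]
        · cases h
      · rcases Sym2.mem_iff.1 h with h | h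
        · cases h
        · rwa [← Sum.inr_injective h]
  have hdom : ∀ e : {e : Sym2 V // e ∈ E}, ∃ f ∈ F, Sum.inl (Sum.inr e) ∈ f ∨
      ∃ d : {g // g ∈ stepEdges E}, Sum.inr d ∈ f ∧ Sum.inr e ∈ d.1 := by
    intro e
    obtain ⟨v, hv⟩ : ∃ v, v ∈ e.1 := ⟨_, Sym2.out_fst_mem e.1⟩
    have hg : s(Sum.inl v, Sum.inr e) ∈ stepEdges E :=
      mem_stepEdges.2 (Or.inr ⟨e, v, hv, rfl⟩)
    have hh : s(Sum.inl (Sum.inr e), Sum.inr ⟨_, hg⟩) ∈ stepEdges (stepEdges E) :=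
      mem_stepEdges.2 (Or.inr ⟨⟨_, hg⟩, Sum.inr e, Sym2.mem_mk_right _ _, rfl⟩)
    by_cases hm : s(Sum.inl (Sum.inr e), Sum.inr ⟨_, hg⟩) ∈ F
    · exact ⟨_, hm, Or.inl (Sym2.mem_mk_left _ _)⟩
    · obtain ⟨f, hf, z, hz, hzf⟩ := hF.2 _ hh hm
      refine ⟨f, hf, ?_⟩
      rcases Sym2.mem_iff.1 hz with rfl | rfl
      · exact Or.inl hzf
      · exact Or.inr ⟨_, hzf, Sym2.mem_mk_right _ _⟩
  choose φ hφF hφ using hdom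
  rw [← Finset.card_attach]
  refine Finset.card_le_card_of_injOn φ (fun e _ => hφF e) fun e _ e' _ h => ?_
  obtain ⟨g, hg, hgF⟩ := hsub _ (hφF e)
  have he : Sum.inr e ∈ g := by
    rcases hφ e with h1 | ⟨d, h1, h2⟩
    exacts [(hgF e).1 h1, (hgF e).2 d h1 h2]
  have he' : Sum.inr e' ∈ g := by
    rcases h ▸ hφ e' with h1 | ⟨d, h1, h2⟩
    exacts [(hgF e').1 h1, (hgF e').2 d h1 h2]
  exact inr_unique_of_mem_stepEdges hg he he'

theorem HasCoveringChoice.exists_edgeDominating {E : Finset (Sym2 V)} (hE : HasCoveringChoice E) :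
    ∃ F, EdgeDominating (stepEdges (stepEdges E)) F ∧ F.card = E.card := by
  obtain ⟨c, hc, hs⟩ := hE
  let ψ : {e : Sym2 V // e ∈ E} →
      Sym2 ((V ⊕ {e : Sym2 V // e ∈ E}) ⊕ {f // f ∈ stepEdges E}) := fun e =>
    Sym2.map Sum.inl s(Sum.inl (c e), Sum.inr e)
  have hψ : Function.Injective ψ := by
    intro e e' h
    have h := Sym2.map.injective Sum.inl_injective h
    simp only [Sym2.eq_iff, Sum.inl.injEq, Sum.inr.injEq, reduceCtorEq, and_self, or_false] at h
    exact h.2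
  have hcov : ∀ y, ∃ f ∈ E.attach.image ψ, Sum.inl y ∈ f := by
    rintro (v | e)
    · obtain ⟨e, rfl⟩ := hs v
      exact ⟨ψ e, Finset.mem_image_of_mem _ (Finset.mem_attach _ _),
        Sym2.mem_map.2 ⟨_, Sym2.mem_mk_left _ _, rfl⟩⟩
    · exact ⟨ψ e, Finset.mem_image_of_mem _ (Finset.mem_attach _ _),
        Sym2.mem_map.2 ⟨_, Sym2.mem_mk_right _ _, rfl⟩⟩
  refine ⟨E.attach.image ψ, ⟨fun f hf => ?_, fun f hf _ => ?_⟩, ?_⟩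
  · obtain ⟨e, -, rfl⟩ := Finset.mem_image.1 hf
    exact mem_stepEdges.2 (Or.inl ⟨_, mem_stepEdges.2 (Or.inr ⟨e, c e, hc e, rfl⟩), rfl⟩)
  · obtain ⟨y, hy⟩ : ∃ y, Sum.inl y ∈ f := by
      rcases mem_stepEdges.1 hf with ⟨g, -, rfl⟩ | ⟨d, v, -, rfl⟩
      · exact ⟨_, Sym2.mem_map.2 ⟨_, Sym2.out_fst_mem g, rfl⟩⟩
      · exact ⟨v, Sym2.mem_mk_left _ _⟩
    obtain ⟨h, hF, hyh⟩ := hcov y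
    exact ⟨h, hF, _, hy, hyh⟩
  · rw [Finset.card_image_of_injective _ hψ, Finset.card_attach]

end

theorem edsNum_pfwStep_pfwStep {X : GraphGen} (hX : HasCoveringChoice X.edges) :
    edsNum (pfwStep (pfwStep X)) = X.edges.card := by
  have hmem : X.edges.card ∈ {k | ∃ F, IsEDS (pfwStep (pfwStep X)) F ∧ F.card = k} :=
    hX.exists_edgeDominating
  refine le_antisymm (Nat.sInf_le hmem) (le_csInf ⟨_, hmem⟩ ?_)
  rintro k ⟨F, hF, rfl⟩
  exact EdgeDominating.card_le_of_stepEdges hF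

theorem pfw_add_two (m : ℕ) : pfw (m + 2) = pfwStep (pfw (m + 1)) := rfl

theorem not_isDiag_of_mem_edges_pfw (m : ℕ) : ∀ e ∈ (pfw (m + 1)).edges, ¬ e.IsDiag := by
  induction m with
  | zero =>
    change ∀ e ∈ ({s(0, 1), s(0, 2), s(1, 2)} : Finset (Sym2 (Fin 3))), ¬ e.IsDiag
    simp
  | succ m ih => exact not_isDiag_of_mem_stepEdges ih

theorem hasCoveringChoice_edges_pfw (m : ℕ) : HasCoveringChoice (pfw (m + 1)).edges := by
  induction m with
  | zero =>
    exact hasCoveringChoice_triangle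
  | succ m ih => exact ih.step

/-- for every `n ≥ 3`, nine times the edge domination number of the
pseudofractal scale-free web `G_n` equals its number of edges. -/
theorem pfw_edsNum_ninth_of_edges (n : ℕ) (hn : 3 ≤ n) :
    9 * edsNum (pfw n) = (pfw n).edges.card := by
  obtain ⟨m, rfl⟩ := Nat.exists_eq_add_of_le' hn
  have hdiag := not_isDiag_of_mem_edges_pfw m
  rw [pfw_add_two (m + 1), pfw_add_two m, edsNum_pfwStep_pfwStep (hasCoveringChoice_edges_pfw m)]
  have h := card_stepEdges (not_isDiag_of_mem_stepEdges hdiag)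
  rw [card_stepEdges hdiag] at h
  exact Eq.trans (by ring) h.symm
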